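/- arXiv:1602.02071 — 3 statements merged into one kernel-verified Lean document; each statement's English description precedes it below -/
import Mathlib

section
/- Asymptotic level of the confidence-band inclusion test for equivalence: suppose the null hypothesis H holds, i.e., there exists s ∈ [t₁,t₂] with A(s) ≤ A₀(s) − ℓ(s) or A(s) ≥ A₀(s) + u(s). Then the test ψ_n = 1{a_n(s) > A₀(s) − ℓ(s) and b_n(s) < A₀(s) + u(s) for all s ∈ [t₁,t₂]}, which rejects H if and only if the combined band (a_n(s), b_n(s))_{s∈[t₁,t₂]} is fully contained in the equivalence region (A₀(s) − ℓ(s), A₀(s) + u(s))_{s∈[t₁,t₂]}, satisfies limsup_{n→∞} E[ψ_n] ≤ α; i.e., the test has asymptotic level α. -/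
open MeasureTheory Filter Set

/-- If two events are separated by a measurable event and the first has probability tending to
`1 - α`, then the second has limiting probability at most `α`. -/
theorem limsup_measure_le_of_separated_coverage
    {Ω : Type*} [MeasurableSpace Ω] (P : Measure Ω) [IsProbabilityMeasure P] {α : ℝ}
    {C R M : ℕ → Set Ω} (hM : ∀ n, MeasurableSet (M n)) (hR : ∀ n, R n ⊆ M n)
    (hC : ∀ n, C n ⊆ (M n)ᶜ)
    (hcov : Tendsto (fun n => (P (C n)).toReal) atTop (nhds (1 - α))) :
    limsup (fun n => (P (R n)).toReal) atTop ≤ α := by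
  have hle : ∀ n, (P (R n)).toReal ≤ 1 - (P (C n)).toReal := fun n => by
    have hRM : P.real (R n) ≤ P.real (M n) := measureReal_mono (hR n)
    have hCM : P.real (C n) ≤ P.real (M n)ᶜ := measureReal_mono (hC n)
    rw [probReal_compl_eq_one_sub (hM n)] at hCM
    simp only [Measure.real] at hRM hCM
    linarith
  have hlim : Tendsto (fun n => 1 - (P (C n)).toReal) atTop (nhds α) := by
    simpa using hcov.const_sub 1
  calc limsup (fun n => (P (R n)).toReal) atTop
      ≤ limsup (fun n => 1 - (P (C n)).toReal) atTop :=
        limsup_le_limsup (Eventually.of_forall hle)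
          (isCoboundedUnder_le_of_le atTop fun _ => ENNReal.toReal_nonneg)
          hlim.isBoundedUnder_le
    _ = α := hlim.limsup_eq

/-- **Asymptotic level of the confidence-band inclusion test for equivalence**: under the
null hypothesis `H` (there is `s ∈ [t₁,t₂]` with `A(s) ≤ A₀(s) − ℓ(s)` or
`A(s) ≥ A₀(s) + u(s)`), the test `ψ_n` that rejects iff the combined band
`(a_n(s), b_n(s))_{s∈[t₁,t₂]}` lies inside the equivalence region
`(A₀(s) − ℓ(s), A₀(s) + u(s))_{s∈[t₁,t₂]}` satisfies `limsup E[ψ_n] ≤ α`. -/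
theorem equivalence_test_asymptotic_level
    {Ω : Type*} [MeasurableSpace Ω] (P : Measure Ω) [IsProbabilityMeasure P]
    (t₁ t₂ : ℝ) (ht : t₁ ≤ t₂) (α : ℝ) (hα : α ∈ Ioo (0 : ℝ) 1)
    -- the true cumulative hazard, the reference function and the equivalence margins
    (A A₀ l u : ℝ → ℝ)
    (hA_cont : ContinuousOn A (Icc t₁ t₂)) (hA_nonneg : ∀ s ∈ Icc t₁ t₂, 0 ≤ A s)
    (hA₀_cont : ContinuousOn A₀ (Icc t₁ t₂)) (hA₀_nonneg : ∀ s ∈ Icc t₁ t₂, 0 ≤ A₀ s)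
    (hA₀_mono : MonotoneOn A₀ (Icc t₁ t₂))
    (hl_cont : ContinuousOn l (Icc t₁ t₂)) (hl_pos : ∀ s ∈ Icc t₁ t₂, 0 < l s)
    (hu_cont : ContinuousOn u (Icc t₁ t₂)) (hu_pos : ∀ s ∈ Icc t₁ t₂, 0 < u s)
    -- the band limit processes, jointly measurable with càdlàg paths
    (a b : ℕ → Ω → ℝ → ℝ)
    (ha_meas : ∀ n, Measurable fun q : Ω × ℝ => a n q.1 q.2)
    (hb_meas : ∀ n, Measurable fun q : Ω × ℝ => b n q.1 q.2)
    (ha_cadlag : ∀ n ω s, s ∈ Icc t₁ t₂ →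
      Tendsto (a n ω) (nhdsWithin s (Ioi s)) (nhds (a n ω s)) ∧
      ∃ L : ℝ, Tendsto (a n ω) (nhdsWithin s (Iio s)) (nhds L))
    (hb_cadlag : ∀ n ω s, s ∈ Icc t₁ t₂ →
      Tendsto (b n ω) (nhdsWithin s (Ioi s)) (nhds (b n ω s)) ∧
      ∃ L : ℝ, Tendsto (b n ω) (nhdsWithin s (Iio s)) (nhds L))
    -- one-sided asymptotic coverage of level 1 − α for each band limit
    (ha_cov : Tendsto
      (fun n => (P {ω | ∀ s ∈ Icc t₁ t₂, a n ω s < A s}).toReal) atTop (nhds (1 - α)))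
    (hb_cov : Tendsto
      (fun n => (P {ω | ∀ s ∈ Icc t₁ t₂, A s < b n ω s}).toReal) atTop (nhds (1 - α)))
    -- the null hypothesis H
    (hnull : ∃ s ∈ Icc t₁ t₂, A s ≤ A₀ s - l s ∨ A₀ s + u s ≤ A s) :
    -- conclusion: the rejection probability is asymptotically at most α
    limsup (fun n => (P {ω | ∀ s ∈ Icc t₁ t₂,
      A₀ s - l s < a n ω s ∧ b n ω s < A₀ s + u s}).toReal) atTop ≤ α := by
  obtain ⟨s, hs, h | h⟩ := hnull
  · refine limsup_measure_le_of_separated_coverage P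
      (M := fun n => {ω | A₀ s - l s < a n ω s})
      (fun n => measurableSet_lt measurable_const
        ((ha_meas n).comp (measurable_id.prodMk measurable_const)))
      (fun n ω hω => (hω s hs).1) (fun n ω hω => ?_) ha_cov
    exact not_lt.mpr ((hω s hs).le.trans h)
  · refine limsup_measure_le_of_separated_coverage P
      (M := fun n => {ω | b n ω s < A₀ s + u s})
      (fun n => measurableSet_lt
        ((hb_meas n).comp (measurable_id.prodMk measurable_const)) measurable_const)
      (fun n ω hω => (hω s hs).2) (fun n ω hω => ?_) hb_cov
    exact not_lt.mpr (h.trans (hω s hs).le)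
end

section
/- Consistency of the confidence-band inclusion test for equivalence: suppose the alternative K holds, i.e., A₀(s) − ℓ(s) < A(s) < A₀(s) + u(s) for all s ∈ [t₁,t₂], and suppose additionally that the band limits are uniformly consistent: sup_{s∈[t₁,t₂]} |a_n(s) − A(s)| → 0 in probability and sup_{s∈[t₁,t₂]} |b_n(s) − A(s)| → 0 in probability as n → ∞. Then the test ψ_n = 1{a_n(s) > A₀(s) − ℓ(s) and b_n(s) < A₀(s) + u(s) for all s ∈ [t₁,t₂]} satisfies E[ψ_n] → 1 as n → ∞; i.e., the probability of correctly rejecting the null hypothesis tends to one. -/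
open MeasureTheory Filter Set

/-- If three sets cover the space, their outer probabilities add up to at least one;
no measurability is needed. -/
lemma one_le_measure_add_of_univ_subset {Ω : Type*} [MeasurableSpace Ω] (P : Measure Ω)
    [IsProbabilityMeasure P] {S T U : Set Ω} (h : univ ⊆ S ∪ (T ∪ U)) :
    1 ≤ P S + (P T + P U) :=
  calc 1 = P univ := measure_univ.symm
    _ ≤ P (S ∪ (T ∪ U)) := measure_mono h
    _ ≤ P S + P (T ∪ U) := measure_union_le _ _
    _ ≤ P S + (P T + P U) := by gcongr; exact measure_union_le _ _

/-- **Consistency of the confidence-band inclusion test for equivalence**: under the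
alternative `K` (`A₀(s) − ℓ(s) < A(s) < A₀(s) + u(s)` for all `s ∈ [t₁,t₂]`) and uniform
consistency of the band limits, the test `ψ_n` that rejects iff the combined band
`(a_n(s), b_n(s))_{s∈[t₁,t₂]}` lies inside the equivalence region satisfies
`E[ψ_n] → 1`. -/
theorem equivalence_test_consistency
    {Ω : Type*} [MeasurableSpace Ω] (P : Measure Ω) [IsProbabilityMeasure P]
    (t₁ t₂ : ℝ) (ht : t₁ ≤ t₂) (α : ℝ) (hα : α ∈ Ioo (0 : ℝ) 1)
    -- the true cumulative hazard, the reference function and the equivalence margins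
    (A A₀ l u : ℝ → ℝ)
    (hA_cont : ContinuousOn A (Icc t₁ t₂)) (hA_nonneg : ∀ s ∈ Icc t₁ t₂, 0 ≤ A s)
    (hA₀_cont : ContinuousOn A₀ (Icc t₁ t₂)) (hA₀_nonneg : ∀ s ∈ Icc t₁ t₂, 0 ≤ A₀ s)
    (hA₀_mono : MonotoneOn A₀ (Icc t₁ t₂))
    (hl_cont : ContinuousOn l (Icc t₁ t₂)) (hl_pos : ∀ s ∈ Icc t₁ t₂, 0 < l s)
    (hu_cont : ContinuousOn u (Icc t₁ t₂)) (hu_pos : ∀ s ∈ Icc t₁ t₂, 0 < u s)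
    -- the band limit processes, jointly measurable with càdlàg paths
    (a b : ℕ → Ω → ℝ → ℝ)
    (ha_meas : ∀ n, Measurable fun q : Ω × ℝ => a n q.1 q.2)
    (hb_meas : ∀ n, Measurable fun q : Ω × ℝ => b n q.1 q.2)
    (ha_cadlag : ∀ n ω s, s ∈ Icc t₁ t₂ →
      Tendsto (a n ω) (nhdsWithin s (Ioi s)) (nhds (a n ω s)) ∧
      ∃ L : ℝ, Tendsto (a n ω) (nhdsWithin s (Iio s)) (nhds L))
    (hb_cadlag : ∀ n ω s, s ∈ Icc t₁ t₂ →
      Tendsto (b n ω) (nhdsWithin s (Ioi s)) (nhds (b n ω s)) ∧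
      ∃ L : ℝ, Tendsto (b n ω) (nhdsWithin s (Iio s)) (nhds L))
    -- one-sided asymptotic coverage of level 1 − α for each band limit
    (ha_cov : Tendsto
      (fun n => (P {ω | ∀ s ∈ Icc t₁ t₂, a n ω s < A s}).toReal) atTop (nhds (1 - α)))
    (hb_cov : Tendsto
      (fun n => (P {ω | ∀ s ∈ Icc t₁ t₂, A s < b n ω s}).toReal) atTop (nhds (1 - α)))
    -- the alternative hypothesis K
    (halt : ∀ s ∈ Icc t₁ t₂, A₀ s - l s < A s ∧ A s < A₀ s + u s)
    -- uniform consistency of the band limits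
    (ha_cons : ∀ ε > (0 : ℝ),
      Tendsto (fun n => P {ω | ∃ s ∈ Icc t₁ t₂, ε ≤ |a n ω s - A s|}) atTop (nhds 0))
    (hb_cons : ∀ ε > (0 : ℝ),
      Tendsto (fun n => P {ω | ∃ s ∈ Icc t₁ t₂, ε ≤ |b n ω s - A s|}) atTop (nhds 0)) :
    -- conclusion: the probability of correctly rejecting the null tends to one
    Tendsto (fun n => (P {ω | ∀ s ∈ Icc t₁ t₂,
      A₀ s - l s < a n ω s ∧ b n ω s < A₀ s + u s}).toReal) atTop (nhds 1) := by
  obtain ⟨ε, hε, hlow⟩ := isCompact_Icc.exists_forall_le'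
    (hA_cont.sub (hA₀_cont.sub hl_cont)) fun s hs => sub_pos.2 (halt s hs).1
  obtain ⟨δ, hδ, hupp⟩ := isCompact_Icc.exists_forall_le'
    ((hA₀_cont.add hu_cont).sub hA_cont) fun s hs => sub_pos.2 (halt s hs).2
  have hbad := (ha_cons ε hε).add (hb_cons δ hδ)
  rw [add_zero] at hbad
  have hlim := ENNReal.Tendsto.sub (tendsto_const_nhds (x := (1 : ENNReal))) hbad
    (Or.inl ENNReal.one_ne_top)
  rw [tsub_zero] at hlim
  have hprob := tendsto_of_tendsto_of_tendsto_of_le_of_le hlim tendsto_const_nhds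
    (fun n => tsub_le_iff_right.2 (one_le_measure_add_of_univ_subset P ?_))
    (fun n => prob_le_one (μ := P) (s := {ω | ∀ s ∈ Icc t₁ t₂,
      A₀ s - l s < a n ω s ∧ b n ω s < A₀ s + u s}))
  · simpa [Function.comp_def] using (ENNReal.tendsto_toReal ENNReal.one_ne_top).comp hprob
  · intro ω _
    by_contra hω
    simp only [mem_union, mem_ofPred_eq, not_or, not_exists, not_and, not_le] at hω
    obtain ⟨hreject, ha, hb⟩ := hω
    refine hreject fun s hs => ?_
    have hlows : ε ≤ A s - (A₀ s - l s) := hlow s hs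
    have hupps : δ ≤ A₀ s + u s - A s := hupp s hs
    exact ⟨by linarith [(abs_lt.1 (ha s hs)).1], by linarith [(abs_lt.1 (hb s hs)).2]⟩
end

section
/- Hadamard differentiability of the quotient functional: let f, g : [t₀,τ] → ℝ be bounded functions with inf_{s∈[t₀,τ]} g(s) > 0. Let (r_n) be a sequence of positive reals with r_n → 0, let h₁, h₂ : [t₀,τ] → ℝ be bounded continuous functions, and let h_{1n}, h_{2n} : [t₀,τ] → ℝ be bounded functions with sup_{s} |h_{1n}(s) − h₁(s)| → 0 and sup_{s} |h_{2n}(s) − h₂(s)| → 0. Then for all sufficiently large n the function g + r_n·h_{2n} is bounded away from zero on [t₀,τ], and sup_{s∈[t₀,τ]} | ( (f(s) + r_n·h_{1n}(s))/(g(s) + r_n·h_{2n}(s)) − f(s)/g(s) )/r_n − ( h₁(s)/g(s) − h₂(s)·f(s)/g(s)² ) | → 0 as n → ∞. In other words, the functional φ(f,g) = f/g is Hadamard differentiable at (f,g), tangentially to pairs of continuous functions, with derivative φ'_{(f,g)}(h₁,h₂) = h₁/g − h₂·f/g², a continuous linear map in (h₁,h₂) with respect to the supremum norm. -/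
open Filter Set

/-- The error of the first-order expansion of the quotient, in closed form. -/
theorem quotient_expansion_error_eq {f g h k a b r : ℝ} (hr : r ≠ 0) (hg : g ≠ 0)
    (hG : g + r * b ≠ 0) :
    ((f + r * a) / (g + r * b) - f / g) / r - (h / g - k * f / g ^ 2) =
      ((a - h) - (b - k) * (f / g) - r * b * (h - k * (f / g)) / g) / (g + r * b) := by
  field_simp
  ring

/-- A perturbation of size at most `c / 2` of a number `g ≥ c` stays above `c / 2`. -/
theorem half_le_add_mul {g b r δ B c : ℝ} (hg : c ≤ g) (hr : 0 ≤ r)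
    (hrδ : r ≤ δ) (hb : |b| ≤ B) (hδ : δ * B ≤ c / 2) : c / 2 ≤ g + r * b := by
  have h : |r * b| ≤ δ * B := by
    rw [abs_mul, abs_of_nonneg hr]
    exact mul_le_mul hrδ hb (abs_nonneg b) (hr.trans hrδ)
  linarith [neg_abs_le (r * b)]

/-- The error of the first-order expansion of the quotient is linear in the size `δ` of the
perturbations. -/
theorem abs_quotient_expansion_error_le {f g h k a b r δ B c F H K : ℝ} (hc : 0 < c)
    (hg : c ≤ g) (hr : 0 < r) (hrδ : r ≤ δ) (hb : |b| ≤ B) (hδ : δ * B ≤ c / 2)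
    (hf : |f| ≤ F) (hh : |h| ≤ H) (hk : |k| ≤ K) (hah : |a - h| ≤ δ) (hbk : |b - k| ≤ δ) :
    |((f + r * a) / (g + r * b) - f / g) / r - (h / g - k * f / g ^ 2)| ≤
      δ * ((1 + F / c + B * (H + K * (F / c)) / c) / (c / 2)) := by
  have hB : 0 ≤ B := (abs_nonneg b).trans hb
  have hF : 0 ≤ F := (abs_nonneg f).trans hf
  have hH : 0 ≤ H := (abs_nonneg h).trans hh
  have hK : 0 ≤ K := (abs_nonneg k).trans hk
  have hδ₀ : 0 ≤ δ := hr.le.trans hrδ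
  have hg₀ : 0 < g := hc.trans_le hg
  have hG : c / 2 ≤ g + r * b := half_le_add_mul hg hr.le hrδ hb hδ
  have hG₀ : 0 < g + r * b := (half_pos hc).trans_le hG
  have hq : |f / g| ≤ F / c := by
    rw [abs_div, abs_of_pos hg₀]
    gcongr
  have hbkq : |(b - k) * (f / g)| ≤ δ * (F / c) := by
    rw [abs_mul]
    gcongr
  have hkq : |h - k * (f / g)| ≤ H + K * (F / c) := by
    refine (abs_sub _ _).trans ?_
    rw [abs_mul]
    gcongr
  have hrem : |r * b * (h - k * (f / g)) / g| ≤ δ * B * (H + K * (F / c)) / c := by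
    rw [abs_div, abs_mul, abs_mul, abs_of_pos hr, abs_of_pos hg₀]
    gcongr
  rw [quotient_expansion_error_eq hr.ne' hg₀.ne' hG₀.ne', abs_div, abs_of_pos hG₀]
  calc _ ≤ (δ + δ * (F / c) + δ * B * (H + K * (F / c)) / c) / (c / 2) := by
        gcongr
        refine (abs_sub _ _).trans (add_le_add ((abs_sub _ _).trans ?_) hrem)
        exact add_le_add hah hbkq
    _ = _ := by ring

/-- **Hadamard differentiability of the quotient functional** `φ(f,g) = f/g` at `(f,g)`,
tangentially to pairs of continuous functions: if `f, g` are bounded on `[t₀,τ]` with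
`inf g > 0`, `r_n → 0` with `r_n > 0`, `h₁, h₂` are bounded continuous and
`h_{1n} → h₁`, `h_{2n} → h₂` uniformly on `[t₀,τ]`, then eventually `g + r_n·h_{2n}` is
bounded away from zero and
`((f + r_n·h_{1n})/(g + r_n·h_{2n}) − f/g)/r_n → h₁/g − h₂·f/g²` uniformly on `[t₀,τ]`. -/
theorem hadamard_differentiability_quotient
    (t₀ τ : ℝ) (ht : t₀ < τ) (ht₀ : 0 ≤ t₀)
    (f g : ℝ → ℝ)
    (hf_bdd : ∃ M : ℝ, ∀ s ∈ Icc t₀ τ, |f s| ≤ M)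
    (hg_bdd : ∃ M : ℝ, ∀ s ∈ Icc t₀ τ, |g s| ≤ M)
    (hg_pos : ∃ c > (0 : ℝ), ∀ s ∈ Icc t₀ τ, c ≤ g s)
    (r : ℕ → ℝ) (hr_pos : ∀ n, 0 < r n) (hr_lim : Tendsto r atTop (nhds 0))
    (h₁ h₂ : ℝ → ℝ)
    (h₁_cont : ContinuousOn h₁ (Icc t₀ τ)) (h₂_cont : ContinuousOn h₂ (Icc t₀ τ))
    (h₁_bdd : ∃ M : ℝ, ∀ s ∈ Icc t₀ τ, |h₁ s| ≤ M)
    (h₂_bdd : ∃ M : ℝ, ∀ s ∈ Icc t₀ τ, |h₂ s| ≤ M)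
    (h1n h2n : ℕ → ℝ → ℝ)
    (h1n_bdd : ∀ n, ∃ M : ℝ, ∀ s ∈ Icc t₀ τ, |h1n n s| ≤ M)
    (h2n_bdd : ∀ n, ∃ M : ℝ, ∀ s ∈ Icc t₀ τ, |h2n n s| ≤ M)
    (h1n_unif : TendstoUniformlyOn h1n h₁ atTop (Icc t₀ τ))
    (h2n_unif : TendstoUniformlyOn h2n h₂ atTop (Icc t₀ τ)) :
    -- eventually `g + r_n·h_{2n}` is bounded away from zero on `[t₀,τ]` …
    (∃ N : ℕ, ∀ n ≥ N, ∃ c > (0 : ℝ), ∀ s ∈ Icc t₀ τ, c ≤ g s + r n * h2n n s) ∧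
    -- … and the difference quotients converge uniformly to the Hadamard derivative
    TendstoUniformlyOn
      (fun n s => ((f s + r n * h1n n s) / (g s + r n * h2n n s) - f s / g s) / r n)
      (fun s => h₁ s / g s - h₂ s * f s / (g s) ^ 2)
      atTop (Icc t₀ τ) := by
  obtain ⟨F, hF⟩ := hf_bdd
  obtain ⟨c, hc, hg⟩ := hg_pos
  obtain ⟨H, hH⟩ := h₁_bdd
  obtain ⟨K, hK⟩ := h₂_bdd
  have hmem : t₀ ∈ Icc t₀ τ := left_mem_Icc.2 ht.le
  have hF₀ : 0 ≤ F := (abs_nonneg _).trans (hF t₀ hmem)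
  have hH₀ : 0 ≤ H := (abs_nonneg _).trans (hH t₀ hmem)
  have hK₀ : 0 ≤ K := (abs_nonneg _).trans (hK t₀ hmem)
  rw [Metric.tendstoUniformlyOn_iff] at h1n_unif h2n_unif
  have hr_small : ∀ δ > 0, ∀ᶠ n in atTop, r n ≤ δ := fun δ hδ =>
    hr_lim.eventually (eventually_le_nhds hδ)
  have hb : ∀ᶠ n in atTop, ∀ s ∈ Icc t₀ τ, |h2n n s| ≤ K + 1 := by
    filter_upwards [h2n_unif 1 one_pos] with n hn s hs
    have hdist := hn s hs
    rw [dist_comm, Real.dist_eq] at hdist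
    linarith [hK s hs, abs_sub_abs_le_abs_sub (h2n n s) (h₂ s)]
  have hδ₀ : 0 < c / 2 / (K + 1) := by positivity
  constructor
  · rw [← eventually_atTop]
    filter_upwards [hb, hr_small _ hδ₀] with n hbn hrn
    exact ⟨c / 2, half_pos hc, fun s hs => half_le_add_mul (hg s hs)
      (hr_pos n).le hrn (hbn s hs) (div_mul_cancel₀ _ (by positivity)).le⟩
  · rw [Metric.tendstoUniformlyOn_iff]
    intro ε hε
    set C := (1 + F / c + (K + 1) * (H + K * (F / c)) / c) / (c / 2)
    have hC₀ : 0 < C := by positivity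
    set δ := min (c / 2 / (K + 1)) (ε / 2 / C)
    have hδ : 0 < δ := lt_min hδ₀ (by positivity)
    filter_upwards [hb, hr_small δ hδ, h1n_unif δ hδ, h2n_unif δ hδ] with n hbn hrn h1 h2 s hs
    have hδK : δ * (K + 1) ≤ c / 2 := (le_div_iff₀ (by positivity)).1 (min_le_left _ _)
    have hδC : δ * C ≤ ε / 2 := (le_div_iff₀ hC₀).1 (min_le_right _ _)
    have ha := h1 s hs
    have hk := h2 s hs
    rw [dist_comm, Real.dist_eq] at ha hk ⊢
    exact (abs_quotient_expansion_error_le hc (hg s hs) (hr_pos n) hrn (hbn s hs) hδK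
      (hF s hs) (hH s hs) (hK s hs) ha.le hk.le).trans_lt
        (hδC.trans_lt (half_lt_self hε))
end
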